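/- Let ξ ∈ ℝ^q and let 𝒜, 𝒜_* ∈ (𝕊^m)^q. Let u be a unit top eigenvector of 𝒜[ξ] and u_* a unit top eigenvector of 𝒜_*[ξ], and set U = u u^T, U_* = u_* u_*^T, so that ⟨U, 𝒜[ξ]⟩ = λ_max(𝒜[ξ]) and ⟨U_*, 𝒜_*[ξ]⟩ = λ_max(𝒜_*[ξ]). Then ( ⟨U_*, 𝒜_*[ξ]⟩ − ⟨U, 𝒜_*[ξ]⟩ )² ≤ ⟨U − U_*, (𝒜 − 𝒜_*)[ξ]⟩² = ⟨𝒜 − 𝒜_*, ξ ⊗ (U − U_*)⟩², i.e. the defect of the surrogate maximizer U for the true pencil 𝒜_*[ξ] is controlled by the correlation of the parameter error with ξ ⊗ (U − U_*). -/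

import Mathlib

open scoped BigOperators

noncomputable section

/-- The quadratic form `v ↦ vᵀ A v`. -/
def rayleigh {m : ℕ} (A : Matrix (Fin m) (Fin m) ℝ) (v : Fin m → ℝ) : ℝ :=
  ∑ i, ∑ j, v i * A i j * v j

/-- The largest eigenvalue of a symmetric matrix. -/
def lambdaMax {m : ℕ} (A : Matrix (Fin m) (Fin m) ℝ) : ℝ :=
  sSup {r : ℝ | ∃ v : Fin m → ℝ, (∑ i, v i ^ 2) = 1 ∧ r = rayleigh A v}

/-- The linear pencil `𝒜[x] = ∑ i, x i • A i`. -/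
def pencil {m q : ℕ} (A : Fin q → Matrix (Fin m) (Fin m) ℝ) (x : Fin q → ℝ) :
    Matrix (Fin m) (Fin m) ℝ := ∑ i, x i • A i

/-- The quadratic form of a pencil is linear in the coefficients. -/
theorem rayleigh_pencil {m q : ℕ} (A : Fin q → Matrix (Fin m) (Fin m) ℝ) (x : Fin q → ℝ)
    (v : Fin m → ℝ) :
    rayleigh (pencil A x) v = ∑ i, x i * ∑ j, ∑ l, A i j l * (v j * v l) := by
  simp only [rayleigh, pencil, Matrix.sum_apply, Matrix.smul_apply, smul_eq_mul, Finset.mul_sum,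
    Finset.sum_mul]
  rw [Finset.sum_comm_cycle]
  refine Finset.sum_congr rfl fun i _ => ?_
  exact Finset.sum_congr rfl fun j _ => Finset.sum_congr rfl fun l _ => by ring

theorem rayleigh_pencil_sub {m q : ℕ} (A B : Fin q → Matrix (Fin m) (Fin m) ℝ) (x : Fin q → ℝ)
    (v : Fin m → ℝ) :
    rayleigh (pencil (fun i => A i - B i) x) v =
      rayleigh (pencil A x) v - rayleigh (pencil B x) v := by
  simp only [rayleigh_pencil, Matrix.sub_apply, sub_mul, Finset.sum_sub_distrib, mul_sub]

/-- The quadratic form on unit vectors is bounded by the sum of the absolute entries. -/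
theorem rayleigh_le_sum_abs {m : ℕ} (M : Matrix (Fin m) (Fin m) ℝ) {v : Fin m → ℝ}
    (hv : (∑ i, v i ^ 2) = 1) : rayleigh M v ≤ ∑ i, ∑ j, |M i j| := by
  have hle (i : Fin m) : |v i| ≤ 1 := by
    rw [← sq_le_one_iff_abs_le_one, ← hv]
    exact Finset.single_le_sum (f := fun i => v i ^ 2) (fun j _ => sq_nonneg _)
      (Finset.mem_univ i)
  refine Finset.sum_le_sum fun i _ => Finset.sum_le_sum fun j _ => ?_
  calc v i * M i j * v j ≤ |v i * M i j * v j| := le_abs_self _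
    _ = |v i| * |M i j| * |v j| := by rw [abs_mul, abs_mul]
    _ ≤ 1 * |M i j| * 1 := by gcongr <;> exact hle _
    _ = |M i j| := by ring

theorem rayleigh_le_lambdaMax {m : ℕ} (M : Matrix (Fin m) (Fin m) ℝ) {v : Fin m → ℝ}
    (hv : (∑ i, v i ^ 2) = 1) : rayleigh M v ≤ lambdaMax M := by
  refine le_csSup ⟨∑ i, ∑ j, |M i j|, ?_⟩ ⟨v, hv, rfl⟩
  rintro _ ⟨w, hw, rfl⟩
  exact rayleigh_le_sum_abs M hw

theorem rayleigh_eq_of_mulVec_eq_smul {m : ℕ} {M : Matrix (Fin m) (Fin m) ℝ} {v : Fin m → ℝ}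
    {r : ℝ} (hv : (∑ i, v i ^ 2) = 1) (h : M.mulVec v = r • v) : rayleigh M v = r := by
  calc rayleigh M v = ∑ i, v i * M.mulVec v i := by
        simp only [rayleigh, Matrix.mulVec, dotProduct, Finset.mul_sum, mul_assoc]
    _ = ∑ i, r * v i ^ 2 := by
        rw [h]
        refine Finset.sum_congr rfl fun i _ => ?_
        rw [Pi.smul_apply, smul_eq_mul]
        ring
    _ = r := by rw [← Finset.mul_sum, hv, mul_one]

/-- The defect of the surrogate maximizer `U = u uᵀ` for the true pencil `𝒜_*[ξ]` is
controlled by the correlation of the parameter error with `ξ ⊗ (U - U_*)`. Here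
`rayleigh M u = ⟨u uᵀ, M⟩` for symmetric `M`. -/
theorem surrogate_defect_bound (q m : ℕ)
    (ξ : Fin q → ℝ) (A Astar : Fin q → Matrix (Fin m) (Fin m) ℝ)
    (hA : ∀ i, (A i).IsSymm) (hAstar : ∀ i, (Astar i).IsSymm)
    (u ustar : Fin m → ℝ)
    (hu : (∑ j, u j ^ 2) = 1) (hus : (∑ j, ustar j ^ 2) = 1)
    (heig : (pencil A ξ).mulVec u = lambdaMax (pencil A ξ) • u)
    (heigs : (pencil Astar ξ).mulVec ustar = lambdaMax (pencil Astar ξ) • ustar) :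
    (rayleigh (pencil Astar ξ) ustar - rayleigh (pencil Astar ξ) u) ^ 2 ≤
      (rayleigh (pencil (fun i => A i - Astar i) ξ) u -
        rayleigh (pencil (fun i => A i - Astar i) ξ) ustar) ^ 2 ∧
    rayleigh (pencil (fun i => A i - Astar i) ξ) u -
        rayleigh (pencil (fun i => A i - Astar i) ξ) ustar =
      ∑ i, ξ i * (∑ j, ∑ l, (A i - Astar i) j l * (u j * u l - ustar j * ustar l)) := by
  have h₁ := rayleigh_eq_of_mulVec_eq_smul hu heig
  have h₂ := rayleigh_eq_of_mulVec_eq_smul hus heigs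
  have h₃ := rayleigh_le_lambdaMax (pencil A ξ) hus
  have h₄ := rayleigh_le_lambdaMax (pencil Astar ξ) hu
  constructor
  · rw [rayleigh_pencil_sub, rayleigh_pencil_sub]
    exact pow_le_pow_left₀ (by linarith) (by linarith) 2
  · simp only [rayleigh_pencil, mul_sub, Finset.sum_sub_distrib]
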